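/- Let k be a non-negative integer and g in P_k. For α in F_{q^n}, the following are equivalent: (i) α belongs to S_{g,k}; (ii) α is G-free, α = g∘β for some β in F_{q^n}, but α ≠ Λ_i∘β for any β in F_{q^n} and any i = 1, ..., t. -/

import Mathlib

open Polynomial UniqueFactorizationMonoid
open scoped Classical

noncomputable section

/-- The action `h ∘ β = Σ_i a_i β^{q^i}` of a polynomial `h = Σ_i a_i x^i` over `F_q`
on an element `β` of an extension field. -/
def polyAct {Fq F : Type*} [Field Fq] [Field F] [Algebra Fq F]
    (q : ℕ) (h : Fq[X]) (β : F) : F :=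
  h.sum fun i a => algebraMap Fq F a * β ^ q ^ i

/-- `h` is the `F_q`-order of `β`: the monic divisor of `x^n - 1` of least degree
annihilating `β`. -/
def IsFqOrder {Fq F : Type*} [Field Fq] [Field F] [Algebra Fq F]
    (q n : ℕ) (h : Fq[X]) (β : F) : Prop :=
  h.Monic ∧ h ∣ (X ^ n - 1 : Fq[X]) ∧ polyAct q h β = 0 ∧
    ∀ h' : Fq[X], h'.Monic → h' ∣ (X ^ n - 1 : Fq[X]) → polyAct q h' β = 0 →
      h.natDegree ≤ h'.natDegree

/-- `α` is `k`-normal over `F_q`: its `F_q`-order has degree `n - k`. -/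
def IsKNormal (Fq : Type*) {F : Type*} [Field Fq] [Field F] [Algebra Fq F]
    (q n k : ℕ) (α : F) : Prop :=
  ∃ h : Fq[X], IsFqOrder q n h α ∧ h.natDegree = n - k

/-- `β` is `h`-free: `gcd(h, (x^n - 1)/Ord_q(β)) = 1`. -/
def IsPolyFree {Fq F : Type*} [Field Fq] [Field F] [Algebra Fq F]
    (q n : ℕ) (h : Fq[X]) (β : F) : Prop :=
  ∃ f : Fq[X], IsFqOrder q n f β ∧ IsCoprime h ((X ^ n - 1 : Fq[X]) / f)

/-- `rad(m)`: product of the distinct primes dividing `m`. -/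
def radN (m : ℕ) : ℕ := ∏ p ∈ m.primeFactors, p

/-- `W(m)`: number of squarefree divisors of `m`. -/
def Wnat (m : ℕ) : ℕ := (m.divisors.filter Squarefree).card

/-- `rad(f)`: product of the distinct monic irreducible factors of `f`. -/
def radPoly {Fq : Type*} [Field Fq] (f : Fq[X]) : Fq[X] :=
  (normalizedFactors f).toFinset.prod id

/-- `W(f)`: number of monic squarefree divisors of `f`. -/
def Wpoly {Fq : Type*} [Field Fq] (f : Fq[X]) : ℕ :=
  {g : Fq[X] | g.Monic ∧ Squarefree g ∧ g ∣ f}.ncard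

/-- The primes `p_1, …, p_s` in the decomposition `r = u·p_1^{b_1}···p_s^{b_s}`:
primes `p ∣ r` such that `p^{b_p + 1} ∣ M` where `b_p` is the multiplicity of `p`
in `r` (here `M = q^n - 1`). -/
def rBadPrimes (r M : ℕ) : Finset ℕ :=
  r.primeFactors.filter fun p => p ^ (r.factorization p + 1) ∣ M

/-- `Q_r^d`: the set of `α ∈ F_{q^n}^*` that are `d`-free, are `r`-th powers, but are
not `λ_j = p_j^{b_j+1}`-th powers for any of the primes `p_j` in the decomposition
of `r`. -/
def QSet (F : Type*) [Field F] (q n r d : ℕ) : Set F :=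
  {α | α ≠ 0 ∧ Nat.gcd d ((q ^ n - 1) / orderOf α) = 1 ∧
    (∃ β : F, β ^ r = α) ∧
    ∀ p ∈ rBadPrimes r (q ^ n - 1), ∀ β : F, β ^ p ^ (r.factorization p + 1) ≠ α}

/-- The irreducible factors `f_1, …, f_t` in the decomposition
`g = π·f_1^{b_1}···f_t^{b_t}`: monic irreducible `f ∣ g` with `f^{b_f + 1} ∣ M`
where `b_f` is the multiplicity of `f` in `g` (here `M = x^n - 1`). -/
def gBadFactors {Fq : Type*} [Field Fq] (g M : Fq[X]) : Finset (Fq[X]) :=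
  (normalizedFactors g).toFinset.filter
    fun f => f ^ ((normalizedFactors g).count f + 1) ∣ M

/-- `T_{g,k}^H`: the set of `α ∈ F_{q^n}` that are `H`-free, of the form `g∘β`, but
not of the form `Λ_i∘β` for `Λ_i = f_i^{b_i+1}`. -/
def TSet {Fq : Type*} (F : Type*) [Field Fq] [Field F] [Algebra Fq F]
    (q n : ℕ) (g H : Fq[X]) : Set F :=
  {α | IsPolyFree q n H α ∧ (∃ β : F, polyAct q g β = α) ∧
    ∀ f ∈ gBadFactors g (X ^ n - 1 : Fq[X]), ∀ β : F,
      polyAct q (f ^ ((normalizedFactors g).count f + 1)) β ≠ α}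

/-- `N_{r,k,g}(h, d, H)`: the number of `β ∈ F_{q^n}` such that `β` is `h`-free,
`g∘β ∈ Q_r^d` and `(g∘β)⁻¹ ∈ T_{g,k}^H`. -/
def Ncnt {Fq : Type*} (F : Type*) [Field Fq] [Field F] [Algebra Fq F]
    (q n r : ℕ) (g h : Fq[X]) (d : ℕ) (H : Fq[X]) : ℕ :=
  {β : F | IsPolyFree q n h β ∧ polyAct q g β ∈ QSet F q n r d ∧
    (polyAct q g β)⁻¹ ∈ TSet F q n g H}.ncard

section FrobeniusModule

variable {Fq F : Type*} [Field Fq] [Field F] [Fintype Fq] [Algebra Fq F]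

theorem polyAct_eq_aeval (h : Fq[X]) (β : F) :
    polyAct (Fintype.card Fq) h β =
      aeval (FiniteField.frobeniusAlgHom Fq F).toLinearMap h β := by
  rw [aeval_eq_sum_range, LinearMap.sum_apply, polyAct, sum_over_range _ (by simp)]
  refine Finset.sum_congr rfl fun i _ => ?_
  have hpow : ((FiniteField.frobeniusAlgHom Fq F).toLinearMap ^ i) β =
      β ^ Fintype.card Fq ^ i := by
    rw [Module.End.pow_apply]
    exact congrFun (pow_iterate (Fintype.card Fq) i) β
  rw [LinearMap.smul_apply, hpow, Algebra.smul_def]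

theorem polyAct_mul (h₁ h₂ : Fq[X]) (β : F) :
    polyAct (Fintype.card Fq) (h₁ * h₂) β =
      polyAct (Fintype.card Fq) h₁ (polyAct (Fintype.card Fq) h₂ β) := by
  simp only [polyAct_eq_aeval, map_mul, Module.End.mul_apply]

theorem polyAct_zero_right (h : Fq[X]) : polyAct (Fintype.card Fq) h (0 : F) = 0 := by
  rw [polyAct_eq_aeval, map_zero]

theorem polyAct_X_pow_sub_one [Finite F] (β : F) :
    polyAct (Fintype.card Fq) (X ^ Module.finrank Fq F - 1 : Fq[X]) β = 0 := by
  rw [polyAct_eq_aeval, ← FiniteField.minpoly_frobeniusAlgHom, minpoly.aeval,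
    LinearMap.zero_apply]

/-- The kernel of the action of `h` consists of roots of a `q`-polynomial of degree
`q ^ natDegree h`. -/
theorem finrank_ker_aeval_frobenius_le [Finite F] {h : Fq[X]} (hh : h ≠ 0) :
    Module.finrank Fq (LinearMap.ker (aeval (FiniteField.frobeniusAlgHom Fq F).toLinearMap h))
      ≤ h.natDegree := by
  have := Fintype.ofFinite F
  set q := Fintype.card Fq
  have hq1 : 1 < q := Fintype.one_lt_card
  set K := LinearMap.ker (aeval (FiniteField.frobeniusAlgHom Fq F).toLinearMap h)
  let L : F[X] := ∑ i ∈ Finset.range (h.natDegree + 1),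
    C (algebraMap Fq F (h.coeff i)) * X ^ q ^ i
  have hL : L ≠ 0 := by
    intro h0
    have hc : L.coeff (q ^ h.natDegree) = algebraMap Fq F (h.coeff h.natDegree) := by
      simp only [L, finsetSum_coeff, coeff_C_mul, coeff_X_pow]
      rw [Finset.sum_eq_single h.natDegree]
      · simp
      · intro i _ hi
        rw [if_neg fun he => hi (Nat.pow_right_injective hq1 he).symm, mul_zero]
      · simp
    rw [h0, coeff_zero, eq_comm, map_eq_zero] at hc
    exact hh (leadingCoeff_eq_zero.mp hc)
  have hdeg : L.natDegree ≤ q ^ h.natDegree := by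
    refine natDegree_sum_le_of_forall_le _ _ fun i hi => ?_
    refine (natDegree_C_mul_X_pow_le _ _).trans (Nat.pow_le_pow_right hq1.le ?_)
    exact Nat.lt_succ_iff.mp (Finset.mem_range.mp hi)
  have hroot : (Finset.univ.filter (· ∈ K)).val ⊆ L.roots := by
    intro x hx
    have hxK : x ∈ K := (Finset.mem_filter.mp (Finset.mem_val.mp hx)).2
    rw [mem_roots hL, IsRoot]
    rw [LinearMap.mem_ker, ← polyAct_eq_aeval, polyAct, sum_over_range _ (by simp)] at hxK
    simpa [L, eval_finsetSum] using hxK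
  have hcard := (card_le_degree_of_subset_roots hroot).trans hdeg
  rw [← Fintype.card_subtype, show Fintype.card {x // x ∈ K} = Fintype.card K from rfl,
    Module.card_eq_pow_finrank (K := Fq)] at hcard
  exact (Nat.pow_le_pow_iff_right hq1).mp hcard

/-- An element is in the image of a divisor of `x^n - 1` iff it is annihilated by the
complementary divisor. -/
theorem exists_polyAct_eq_iff [Finite F] {a b : Fq[X]}
    (hab : a * b = X ^ Module.finrank Fq F - 1) (α : F) :
    (∃ β : F, polyAct (Fintype.card Fq) a β = α) ↔ polyAct (Fintype.card Fq) b α = 0 := by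
  have hM : (X ^ Module.finrank Fq F - 1 : Fq[X]) ≠ 0 :=
    (monic_X_pow_sub_C (1 : Fq) Module.finrank_pos.ne').ne_zero
  have ha : a ≠ 0 := by rintro rfl; exact hM (by rw [← hab, zero_mul])
  have hb : b ≠ 0 := by rintro rfl; exact hM (by rw [← hab, mul_zero])
  set φ := (FiniteField.frobeniusAlgHom Fq F).toLinearMap
  have hle : LinearMap.range (aeval φ a) ≤ LinearMap.ker (aeval φ b) := by
    rintro _ ⟨β, rfl⟩
    rw [LinearMap.mem_ker, ← polyAct_eq_aeval, ← polyAct_eq_aeval, ← polyAct_mul, mul_comm,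
      hab, polyAct_X_pow_sub_one]
  have heq : LinearMap.range (aeval φ a) = LinearMap.ker (aeval φ b) := by
    refine Submodule.eq_of_le_of_finrank_le hle ?_
    have h₁ := LinearMap.finrank_range_add_finrank_ker (aeval φ a)
    have h₂ : Module.finrank Fq (LinearMap.ker (aeval φ a)) ≤ a.natDegree :=
      finrank_ker_aeval_frobenius_le ha
    have h₃ : Module.finrank Fq (LinearMap.ker (aeval φ b)) ≤ b.natDegree :=
      finrank_ker_aeval_frobenius_le hb
    have h₄ : a.natDegree + b.natDegree = Module.finrank Fq F := by
      rw [← natDegree_mul ha hb, hab]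
      exact natDegree_X_pow_sub_C (r := (1 : Fq))
    omega
  rw [polyAct_eq_aeval, ← LinearMap.mem_ker, ← heq, LinearMap.mem_range]
  simp only [polyAct_eq_aeval, φ]

theorem IsFqOrder.dvd_iff {n : ℕ} {h : Fq[X]} {α : F}
    (hh : IsFqOrder (Fintype.card Fq) n h α) (f : Fq[X]) :
    h ∣ f ↔ polyAct (Fintype.card Fq) f α = 0 := by
  obtain ⟨hmonic, hdvd, hzero, hmin⟩ := hh
  constructor
  · rintro ⟨c, rfl⟩
    rw [mul_comm, polyAct_mul, hzero, polyAct_zero_right]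
  · intro hf
    set d := EuclideanDomain.gcd h f
    have hdh : d ∣ h := EuclideanDomain.gcd_dvd_left h f
    have hd0 : d ≠ 0 := ne_zero_of_dvd_ne_zero hmonic.ne_zero hdh
    have hact : polyAct (Fintype.card Fq) (normalize d) α = 0 := by
      rw [normalize_apply, mul_comm, polyAct_mul]
      have : polyAct (Fintype.card Fq) d α = 0 := by
        rw [show d = EuclideanDomain.gcdA h f * h + EuclideanDomain.gcdB h f * f by
          rw [mul_comm _ h, mul_comm _ f]; exact EuclideanDomain.gcd_eq_gcd_ab h f,
          polyAct_eq_aeval, map_add, LinearMap.add_apply, ← polyAct_eq_aeval,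
          ← polyAct_eq_aeval, polyAct_mul, polyAct_mul, hzero, hf, polyAct_zero_right,
          polyAct_zero_right, add_zero]
      rw [this, polyAct_zero_right]
    have hndh : normalize d ∣ h := normalize_dvd_iff.mpr hdh
    have hle := hmin _ (monic_normalize hd0) (hndh.trans hdvd) hact
    have heq : normalize d = h :=
      (eq_of_monic_of_dvd_of_natDegree_le (monic_normalize hd0) hmonic hndh hle).symm
    rw [← heq, normalize_dvd_iff]
    exact EuclideanDomain.gcd_dvd_right h f

/-- For a divisor `a` of `x^n - 1`, `α` is of the form `a ∘ β` iff `a` divides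
`(x^n - 1) / Ord_q(α)`. -/
theorem IsFqOrder.exists_polyAct_eq_iff_dvd [Finite F] {h m a : Fq[X]} {α : F}
    (hh : IsFqOrder (Fintype.card Fq) (Module.finrank Fq F) h α)
    (hm : h * m = X ^ Module.finrank Fq F - 1)
    (ha : a ∣ (X ^ Module.finrank Fq F - 1 : Fq[X])) :
    (∃ β : F, polyAct (Fintype.card Fq) a β = α) ↔ a ∣ m := by
  obtain ⟨b, hb⟩ := ha
  have hM : (X ^ Module.finrank Fq F - 1 : Fq[X]) ≠ 0 :=
    (monic_X_pow_sub_C (1 : Fq) Module.finrank_pos.ne').ne_zero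
  have hb0 : b ≠ 0 := by rintro rfl; exact hM (by rw [hb, mul_zero])
  rw [exists_polyAct_eq_iff hb.symm, ← hh.dvd_iff]
  constructor
  · rintro ⟨c, rfl⟩
    refine ⟨c, mul_left_cancel₀ hh.1.ne_zero ?_⟩
    rw [hm, hb]
    ring
  · rintro ⟨c, rfl⟩
    have ha0 : a ≠ 0 := by rintro rfl; exact hM (by rw [hb, zero_mul])
    refine ⟨c, mul_left_cancel₀ ha0 ?_⟩
    rw [← hb, ← hm]
    ring

end FrobeniusModule

section Radical

variable {Fq : Type*} [Field Fq]

theorem radPoly_div_radPoly {g M : Fq[X]} (hM : M ≠ 0) (hg : g ∣ M) :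
    radPoly M / radPoly g =
      ∏ p ∈ (normalizedFactors M).toFinset \ (normalizedFactors g).toFinset, p := by
  have hg0 : g ≠ 0 := ne_zero_of_dvd_ne_zero hM hg
  have hsub : (normalizedFactors g).toFinset ⊆ (normalizedFactors M).toFinset :=
    Multiset.toFinset_subset.mpr
      (Multiset.subset_of_le ((dvd_iff_normalizedFactors_le_normalizedFactors hg0 hM).mp hg))
  have hne : radPoly g ≠ 0 := Finset.prod_ne_zero_iff.mpr fun p hp =>
    (irreducible_of_normalized_factor p (Multiset.mem_toFinset.mp hp)).ne_zero
  refine (EuclideanDomain.eq_div_of_mul_eq_left hne ?_).symm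
  exact Finset.prod_sdiff hsub

/-- `m` is coprime to `rad(M)/rad(g)` iff every common monic irreducible factor of `M` and `m`
divides `g`. -/
theorem isCoprime_radPoly_div_iff {g M : Fq[X]} (hM : M ≠ 0) (hg : g ∣ M) (m : Fq[X]) :
    IsCoprime (radPoly M / radPoly g) m ↔
      ∀ p ∈ normalizedFactors M, p ∣ m → p ∈ normalizedFactors g := by
  rw [radPoly_div_radPoly hM hg, IsCoprime.prod_left_iff]
  refine forall_congr' fun p => ?_
  simp only [Finset.mem_sdiff, Multiset.mem_toFinset]
  constructor
  · intro h hpM hpm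
    by_contra hpg
    have hirr := irreducible_of_normalized_factor p hpM
    exact (hirr.coprime_iff_not_dvd.mp (h ⟨hpM, hpg⟩)) hpm
  · rintro h ⟨hpM, hpg⟩
    have hirr := irreducible_of_normalized_factor p hpM
    exact hirr.coprime_iff_not_dvd.mpr fun hpm => hpg (h hpM hpm)

theorem not_pow_count_normalizedFactors_succ_dvd {g f : Fq[X]} (hg : g ≠ 0)
    (hf : f ∈ normalizedFactors g) : ¬ f ^ ((normalizedFactors g).count f + 1) ∣ g := by
  intro hdvd
  have hirr := irreducible_of_normalized_factor f hf
  have h := le_emultiplicity_of_pow_dvd hdvd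
  rw [emultiplicity_eq_count_normalizedFactors hirr hg, normalize_normalized_factor f hf] at h
  exact absurd (Nat.cast_le.mp h) (Nat.not_succ_le_self _)

theorem pow_count_normalizedFactors_dvd {g f : Fq[X]} (hg : g ≠ 0)
    (hf : f ∈ normalizedFactors g) : f ^ (normalizedFactors g).count f ∣ g := by
  have hirr := irreducible_of_normalized_factor f hf
  refine pow_dvd_of_le_emultiplicity ?_
  rw [emultiplicity_eq_count_normalizedFactors hirr hg, normalize_normalized_factor f hf]

/-- Divisors `m` of `M` lying above `g` are equal to `g` iff they are coprime to
`rad(M)/rad(g)` and not divisible by any `f ^ (b + 1)`. -/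
theorem eq_iff_isCoprime_radPoly_div_and_forall_not_dvd {g m M : Fq[X]} (hM : M ≠ 0)
    (hgm : g.Monic) (hmm : m.Monic) (hgdvd : g ∣ m) (hmdvd : m ∣ M) :
    m = g ↔ IsCoprime (radPoly M / radPoly g) m ∧
      ∀ f ∈ gBadFactors g M, ¬ f ^ ((normalizedFactors g).count f + 1) ∣ m := by
  rw [isCoprime_radPoly_div_iff hM (hgdvd.trans hmdvd)]
  simp only [gBadFactors, Finset.mem_filter, Multiset.mem_toFinset]
  constructor
  · rintro rfl
    exact ⟨fun p hp hpm => (mem_normalizedFactors_iff' hgm.ne_zero).mpr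
      ⟨irreducible_of_normalized_factor p hp, normalize_normalized_factor p hp, hpm⟩,
      fun f hf => not_pow_count_normalizedFactors_succ_dvd hgm.ne_zero hf.1⟩
  · rintro ⟨hcop, hbad⟩
    obtain ⟨c, rfl⟩ := hgdvd
    have hc : c.Monic := hgm.of_mul_monic_left hmm
    by_cases hcu : IsUnit c
    · rw [hc.eq_one_of_isUnit hcu, mul_one]
    · exfalso
      obtain ⟨p, hp⟩ := exists_mem_normalizedFactors hc.ne_zero hcu
      have hpc : p ∣ c := dvd_of_mem_normalizedFactors hp
      have hpM : p ∈ normalizedFactors M := (mem_normalizedFactors_iff' hM).mpr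
        ⟨irreducible_of_normalized_factor p hp, normalize_normalized_factor p hp,
          (hpc.trans (dvd_mul_left c g)).trans hmdvd⟩
      have hpg := hcop p hpM (hpc.trans (dvd_mul_left c g))
      have hpow : p ^ ((normalizedFactors g).count p + 1) ∣ g * c := by
        rw [pow_succ]
        exact mul_dvd_mul (pow_count_normalizedFactors_dvd hgm.ne_zero hpg) hpc
      exact hbad p ⟨hpg, hpow.trans hmdvd⟩ hpow

end Radical

/-- For `g ∈ P_k`, an element `α ∈ F_{q^n}` lies in `S_{g,k}` if and only if `α` is
`G`-free (`G = rad(x^n-1)/rad(g)`), `α = g∘β` for some `β`, and `α ≠ Λ_i∘β` for every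
`β` and every `Λ_i = f_i^{b_i+1}` coming from the decomposition of `g`. -/
theorem mem_Sgk_iff
    (q n k : ℕ) (hq : IsPrimePow q) (hn : 0 < n)
    (Fq F : Type*) [Field Fq] [Field F] [Fintype Fq] [Fintype F] [Algebra Fq F]
    (hcard : Fintype.card Fq = q) (hdim : Module.finrank Fq F = n)
    (g : Fq[X]) (hgm : g.Monic) (hgd : g.natDegree = k)
    (hgdvd : g ∣ (X ^ n - 1 : Fq[X])) (α : F) :
    (IsKNormal Fq q n k α ∧ ∃ β : F, polyAct q g β = α) ↔
      (IsPolyFree q n (radPoly (X ^ n - 1 : Fq[X]) / radPoly g) α ∧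
        (∃ β : F, polyAct q g β = α) ∧
        ∀ f ∈ gBadFactors g (X ^ n - 1 : Fq[X]), ∀ β : F,
          polyAct q (f ^ ((normalizedFactors g).count f + 1)) β ≠ α) := by
  subst hcard hdim
  have hMm : (X ^ Module.finrank Fq F - 1 : Fq[X]).Monic := monic_X_pow_sub_C (1 : Fq) hn.ne'
  have hMd : (X ^ Module.finrank Fq F - 1 : Fq[X]).natDegree = Module.finrank Fq F :=
    natDegree_X_pow_sub_C (r := (1 : Fq))
  have key : ∀ h : Fq[X], IsFqOrder (Fintype.card Fq) (Module.finrank Fq F) h α →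
      (∃ β : F, polyAct (Fintype.card Fq) g β = α) →
      (h.natDegree = Module.finrank Fq F - k ↔
        IsCoprime (radPoly (X ^ Module.finrank Fq F - 1 : Fq[X]) / radPoly g)
          ((X ^ Module.finrank Fq F - 1 : Fq[X]) / h) ∧
        ∀ f ∈ gBadFactors g (X ^ Module.finrank Fq F - 1 : Fq[X]), ∀ β : F,
          polyAct (Fintype.card Fq) (f ^ ((normalizedFactors g).count f + 1)) β ≠ α) := by
    intro h hh hβ
    have hmul : h * ((X ^ Module.finrank Fq F - 1 : Fq[X]) / h) = X ^ Module.finrank Fq F - 1 :=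
      EuclideanDomain.mul_div_cancel' hh.1.ne_zero hh.2.1
    generalize (X ^ Module.finrank Fq F - 1 : Fq[X]) / h = m at hmul ⊢
    have hmm : m.Monic := hh.1.of_mul_monic_left (hmul ▸ hMm)
    have hgdm : g ∣ m := (hh.exists_polyAct_eq_iff_dvd hmul hgdvd).mp hβ
    have hmdvd : m ∣ (X ^ Module.finrank Fq F - 1 : Fq[X]) := ⟨h, by rw [← hmul, mul_comm]⟩
    have hbad : (∀ f ∈ gBadFactors g (X ^ Module.finrank Fq F - 1 : Fq[X]), ∀ β : F,
          polyAct (Fintype.card Fq) (f ^ ((normalizedFactors g).count f + 1)) β ≠ α) ↔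
        ∀ f ∈ gBadFactors g (X ^ Module.finrank Fq F - 1 : Fq[X]),
          ¬ f ^ ((normalizedFactors g).count f + 1) ∣ m := by
      refine forall₂_congr fun f hf => ?_
      rw [← hh.exists_polyAct_eq_iff_dvd hmul (Finset.mem_filter.mp hf).2, not_exists]
    rw [hbad, ← eq_iff_isCoprime_radPoly_div_and_forall_not_dvd hMm.ne_zero hgm hmm hgdm hmdvd]
    have hsum : h.natDegree + m.natDegree = Module.finrank Fq F := by
      rw [← hh.1.natDegree_mul hmm, hmul, hMd]
    have hgle := natDegree_le_of_dvd hgdm hmm.ne_zero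
    constructor
    · intro hd
      exact eq_of_monic_of_dvd_of_natDegree_le hgm hmm hgdm (by omega)
    · rintro rfl
      omega
  constructor
  · rintro ⟨⟨h, hh, hd⟩, hβ⟩
    obtain ⟨hcop, hbad⟩ := (key h hh hβ).mp hd
    exact ⟨⟨h, hh, hcop⟩, hβ, hbad⟩
  · rintro ⟨⟨h, hh, hcop⟩, hβ, hbad⟩
    exact ⟨⟨h, hh, (key h hh hβ).mpr ⟨hcop, hbad⟩⟩, hβ⟩

end
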